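/- There is no injective group homomorphism from the symmetric group 𝔖₄ on 4 letters into GL(2, ℝ), the group of invertible 2×2 real matrices. -/

import Mathlib

/-- An involutive `2 × 2` matrix of determinant one is its own adjugate, hence scalar when `2` is
not a zero divisor. -/
theorem Matrix.exists_eq_scalar_of_mul_self_eq_one {R : Type*} [CommRing R] [NoZeroDivisors R]
    [NeZero (2 : R)] {M : Matrix (Fin 2) (Fin 2) R} (hM : M * M = 1) (hdet : M.det = 1) :
    ∃ a : R, M = Matrix.scalar (Fin 2) a := by
  have hadj : M = M.adjugate := by
    calc M = M * (M * M.adjugate) := by rw [Matrix.mul_adjugate, hdet, one_smul, mul_one]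
      _ = M.adjugate := by rw [← mul_assoc, hM, one_mul]
  rw [Matrix.adjugate_fin_two] at hadj
  have eq_zero {x : R} (hx : x = -x) : x = 0 := by
    have h : (2 : R) * x = 0 := by linear_combination hx
    exact (mul_eq_zero.mp h).resolve_left two_ne_zero
  have h01 : M 0 1 = 0 := eq_zero (by simpa using congrFun₂ hadj 0 1)
  have h10 : M 1 0 = 0 := eq_zero (by simpa using congrFun₂ hadj 1 0)
  have h11 : M 1 1 = M 0 0 := by simpa using congrFun₂ hadj 1 1
  refine ⟨M 0 0, ?_⟩
  ext i j
  fin_cases i <;> fin_cases j <;> simp [h01, h10, h11]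

/-- The square of an element of `GL(2, ℝ)` whose fourth power is one is central. -/
theorem Matrix.GeneralLinearGroup.commute_sq_of_pow_four_eq_one
    {A : Matrix.GeneralLinearGroup (Fin 2) ℝ} (hA : A ^ 4 = 1)
    (B : Matrix.GeneralLinearGroup (Fin 2) ℝ) : Commute (A ^ 2) B := by
  have hM : (A : Matrix (Fin 2) (Fin 2) ℝ) ^ 4 = 1 := by
    simpa using congrArg Units.val hA
  have hdet : ((A : Matrix (Fin 2) (Fin 2) ℝ) ^ 2).det = 1 := by
    have h : (A : Matrix (Fin 2) (Fin 2) ℝ).det ^ 4 = 1 := by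
      rw [← Matrix.det_pow, hM, Matrix.det_one]
    rw [Matrix.det_pow]
    nlinarith [sq_nonneg (A : Matrix (Fin 2) (Fin 2) ℝ).det]
  obtain ⟨a, ha⟩ := Matrix.exists_eq_scalar_of_mul_self_eq_one
    (by rw [← pow_add, hM] : (A : Matrix (Fin 2) (Fin 2) ℝ) ^ 2 * A.val ^ 2 = 1) hdet
  apply Units.ext
  rw [Units.val_mul, Units.val_mul, Units.val_pow_eq_pow_val, ha]
  exact Matrix.scalar_commute a (Commute.all a) B.val

/-- There is no injective group homomorphism from the symmetric group on 4 letters into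
`GL(2, ℝ)`. -/
theorem stmt_14 :
    ¬ ∃ f : Equiv.Perm (Fin 4) →* Matrix.GeneralLinearGroup (Fin 2) ℝ,
      Function.Injective f := by
  rintro ⟨f, hf⟩
  have hpow : f (finRotate 4) ^ 4 = 1 := by
    rw [← map_pow, show finRotate 4 ^ 4 = 1 by decide, map_one]
  have hcomm := Matrix.GeneralLinearGroup.commute_sq_of_pow_four_eq_one hpow (f (Equiv.swap 0 1))
  rw [← map_pow] at hcomm
  exact absurd (hf (by simpa only [map_mul] using hcomm.eq) :
    finRotate 4 ^ 2 * Equiv.swap 0 1 = Equiv.swap 0 1 * finRotate 4 ^ 2) (by decide)
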